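/- For every real ν ≥ 1 and every real α > 0, there exists μ ≥ 0 such that for every quantum state ρ in K^f: Tr(𝔏_L(ρ)·N^ν) ≤ −ν·(Tr(ρ·N^ν))^((ν+1)/ν) + μ. -/

import Mathlib

/-!
STATEMENT 2: For every real ν ≥ 1 and every real α > 0, there exists μ ≥ 0 such
that for every quantum state ρ in K^f:
Tr(𝔏_L(ρ)·N^ν) ≤ −ν·(Tr(ρ·N^ν))^((ν+1)/ν) + μ.
-/

open scoped ComplexOrder

noncomputable section

abbrev FockSpace : Type := ℕ →₀ ℂ

/-- The annihilation operator `a`: `a e_n = √n e_{n-1}` (and `a e_0 = 0`),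
equivalently `(a ψ)(n) = √(n+1) ψ(n+1)`. -/
noncomputable def ann : Module.End ℂ FockSpace :=
  Finsupp.lsum ℂ fun n => (Real.sqrt n : ℂ) • Finsupp.lsingle (n - 1)

/-- The creation operator `a†`: `a† e_n = √(n+1) e_{n+1}`. -/
noncomputable def cre : Module.End ℂ FockSpace :=
  Finsupp.lsum ℂ fun n => (Real.sqrt (n + 1) : ℂ) • Finsupp.lsingle (n + 1)

/-- `L = a² − α²·I`. -/
noncomputable def Lop (α : ℝ) : Module.End ℂ FockSpace :=
  ann ^ 2 - ((α : ℂ) ^ 2) • 1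

/-- `L† = (a†)² − α²·I`. -/
noncomputable def Ldag (α : ℝ) : Module.End ℂ FockSpace :=
  cre ^ 2 - ((α : ℂ) ^ 2) • 1

/-- The Lindblad super-operator `𝔏_A(ρ) = AρA† − (A†Aρ + ρA†A)/2`,
with the adjoint `A†` supplied explicitly. -/
noncomputable def lind (A Adag ρ : Module.End ℂ FockSpace) : Module.End ℂ FockSpace :=
  A * ρ * Adag - (2⁻¹ : ℂ) • (Adag * A * ρ + ρ * (Adag * A))

/-- `N^ν`: the diagonal operator `(N^ν ψ)(n) = n^ν ψ(n)` (real power). -/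
noncomputable def Npow (ν : ℝ) : Module.End ℂ FockSpace :=
  Finsupp.lsum ℂ fun n => ((((n : ℝ) ^ ν : ℝ)) : ℂ) • Finsupp.lsingle n

/-- Trace: sum of the diagonal entries in the Fock basis. -/
noncomputable def trOp (T : Module.End ℂ FockSpace) : ℂ :=
  ∑' n : ℕ, T (Finsupp.single n 1) n

/-- The ℓ² inner product on finitely supported sequences. -/
noncomputable def ip (ψ φ : FockSpace) : ℂ :=
  ∑' n : ℕ, (starRingEnd ℂ) (ψ n) * φ n

/-- `K^f`: Hermitian operators whose range lies in the span of finitely many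
Fock basis vectors. -/
def MemKf (ρ : Module.End ℂ FockSpace) : Prop :=
  (∀ ψ φ : FockSpace, ip (ρ ψ) φ = ip ψ (ρ φ)) ∧
  ∃ S : Finset ℕ, ∀ ψ : FockSpace, ∀ n ∉ S, ρ ψ n = 0

/-- A quantum state in `K^f`: positive semidefinite element of `K^f` of trace 1. -/
def IsQuantumState (ρ : Module.End ℂ FockSpace) : Prop :=
  MemKf ρ ∧ (∀ ψ : FockSpace, 0 ≤ ip ψ (ρ ψ)) ∧ trOp ρ = 1

lemma ann_single (n : ℕ) :
    ann (Finsupp.single n 1) = (Real.sqrt n : ℂ) • Finsupp.single (n - 1) 1 := by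
  simp [ann]

lemma cre_single (n : ℕ) :
    cre (Finsupp.single n 1) = (Real.sqrt (n + 1) : ℂ) • Finsupp.single (n + 1) 1 := by
  simp [cre]

lemma Npow_single (ν : ℝ) (n : ℕ) :
    Npow ν (Finsupp.single n 1) = (((n : ℝ) ^ ν : ℝ) : ℂ) • Finsupp.single n 1 := by
  simp [Npow]

lemma ann_apply (ψ : FockSpace) (n : ℕ) : ann ψ n = (Real.sqrt (n + 1) : ℂ) * ψ (n + 1) := by
  induction ψ using Finsupp.induction_linear with
  | zero => simp
  | add f g hf hg => simp [hf, hg, mul_add]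
  | single m c =>
    rcases m with _ | m
    · simp [ann]
    · by_cases h : m = n
      · subst h; simp [ann]
      · simp [ann, h]

lemma cre_apply_zero (ψ : FockSpace) : cre ψ 0 = 0 := by
  induction ψ using Finsupp.induction_linear with
  | zero => simp
  | add f g hf hg => simp [hf, hg]
  | single m c => simp [cre]

lemma cre_apply_succ (ψ : FockSpace) (n : ℕ) :
    cre ψ (n + 1) = (Real.sqrt (n + 1) : ℂ) * ψ n := by
  induction ψ using Finsupp.induction_linear with
  | zero => simp
  | add f g hf hg => simp [hf, hg, mul_add]
  | single m c =>
    by_cases h : m = n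
    · subst h; simp [cre]
    · simp [cre, h]

/-- The matrix element `⟨e_{n+2}, (a†)² e_n⟩ = √(n+1) √(n+2)`. -/
def ladder (n : ℕ) : ℝ := Real.sqrt (n + 1) * Real.sqrt (n + 2)

lemma ladder_nonneg (n : ℕ) : 0 ≤ ladder n := by unfold ladder; positivity

lemma ladder_sq (n : ℕ) : ladder n ^ 2 = ((n : ℝ) + 1) * (n + 2) := by
  unfold ladder
  rw [mul_pow, Real.sq_sqrt (by positivity), Real.sq_sqrt (by positivity)]

lemma ladder_le (n : ℕ) : ladder n ≤ n + 2 := by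
  refine abs_le_of_sq_le_sq' ?_ (by positivity) |>.2
  rw [ladder_sq]
  nlinarith [(Nat.cast_nonneg n : (0 : ℝ) ≤ n)]

lemma Lop_apply (α : ℝ) (ψ : FockSpace) (n : ℕ) :
    Lop α ψ n = (ladder n : ℂ) * ψ (n + 2) - (α : ℂ) ^ 2 * ψ n := by
  simp [Lop, pow_two ann, ann_apply, ladder]
  norm_num [add_assoc, mul_assoc]

lemma Ldag_apply_add_two (α : ℝ) (ψ : FockSpace) (n : ℕ) :
    Ldag α ψ (n + 2) = (ladder n : ℂ) * ψ n - (α : ℂ) ^ 2 * ψ (n + 2) := by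
  simp [Ldag, pow_two cre, cre_apply_succ, ladder]
  norm_num [add_assoc]
  ring

lemma Ldag_apply_of_lt_two (α : ℝ) (ψ : FockSpace) {n : ℕ} (hn : n < 2) :
    Ldag α ψ n = - ((α : ℂ) ^ 2 * ψ n) := by
  interval_cases n
  · simp [Ldag, pow_two cre, cre_apply_zero]
  · have := cre_apply_succ (cre ψ) 0
    simp [cre_apply_zero] at this
    simp [Ldag, pow_two cre, this]

lemma Ldag_single (α : ℝ) (n : ℕ) :
    Ldag α (Finsupp.single n 1) =
      (ladder n : ℂ) • Finsupp.single (n + 2) 1 - ((α : ℂ) ^ 2) • Finsupp.single n 1 := by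
  simp only [Ldag, pow_two cre, LinearMap.sub_apply, Module.End.mul_apply, cre_single, map_smul,
    LinearMap.smul_apply, Module.End.one_apply, smul_smul, ladder]
  norm_num [add_assoc]

lemma Lop_single_add_two (α : ℝ) (n : ℕ) :
    Lop α (Finsupp.single (n + 2) 1) =
      (ladder n : ℂ) • Finsupp.single n 1 - ((α : ℂ) ^ 2) • Finsupp.single (n + 2) 1 := by
  simp only [Lop, pow_two ann, LinearMap.sub_apply, Module.End.mul_apply, ann_single, map_smul,
    LinearMap.smul_apply, Module.End.one_apply, smul_smul, ladder]
  norm_num [add_assoc, mul_comm]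

lemma Lop_single_of_lt_two (α : ℝ) {n : ℕ} (hn : n < 2) :
    Lop α (Finsupp.single n 1) = - (((α : ℂ) ^ 2) • Finsupp.single n 1) := by
  interval_cases n <;>
  simp only [Lop, pow_two ann, LinearMap.sub_apply, Module.End.mul_apply, ann_single, map_smul,
    LinearMap.smul_apply, Module.End.one_apply] <;> simp

lemma ip_eq_sum (ψ φ : FockSpace) :
    ip ψ φ = ψ.sum fun n c => (starRingEnd ℂ) c * φ n := by
  unfold ip Finsupp.sum
  apply tsum_eq_sum
  intro n hn
  simp [Finsupp.notMem_support_iff.mp hn]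

lemma ip_single_left (n : ℕ) (φ : FockSpace) : ip (Finsupp.single n 1) φ = φ n := by
  rw [ip_eq_sum, Finsupp.sum_single_index] <;> simp

lemma ip_single_right (n : ℕ) (φ : FockSpace) :
    ip φ (Finsupp.single n 1) = (starRingEnd ℂ) (φ n) := by
  unfold ip
  rw [tsum_eq_single n]
  · simp
  · intro m hm
    simp [hm.symm]

lemma ip_sub_left (ψ χ φ : FockSpace) : ip (ψ - χ) φ = ip ψ φ - ip χ φ := by
  simp only [ip_eq_sum]
  exact Finsupp.sum_sub_index fun n b₁ b₂ => by rw [map_sub, sub_mul]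

lemma MemKf.conj_apply {ρ : Module.End ℂ FockSpace} (h : MemKf ρ) (m n : ℕ) :
    ρ (Finsupp.single n 1) m = (starRingEnd ℂ) (ρ (Finsupp.single m 1) n) := by
  have := h.1 (Finsupp.single m 1) (Finsupp.single n 1)
  rw [ip_single_left, ip_single_right] at this
  exact this.symm

lemma MemKf.exists_bound {ρ : Module.End ℂ FockSpace} (h : MemKf ρ) :
    ∃ M : ℕ, ∀ m n, (M ≤ m ∨ M ≤ n) → ρ (Finsupp.single n 1) m = 0 := by
  obtain ⟨S, hS⟩ := h.2
  have key : ∀ k, S.sup id + 1 ≤ k → k ∉ S := fun k hk hkS => by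
    have : k ≤ S.sup id := Finset.le_sup (f := id) hkS
    omega
  refine ⟨S.sup id + 1, fun m n hmn => ?_⟩
  rcases hmn with hm | hn
  · exact hS _ _ (key m hm)
  · rw [h.conj_apply, hS _ _ (key n hn), map_zero]

lemma re_offdiag_le {ρ : Module.End ℂ FockSpace} (h : MemKf ρ)
    (hpos : ∀ ψ : FockSpace, 0 ≤ ip ψ (ρ ψ)) (m n : ℕ) :
    (ρ (Finsupp.single n 1) m).re ≤
      ((ρ (Finsupp.single n 1) n).re + (ρ (Finsupp.single m 1) m).re) / 2 := by
  have h0 := hpos (Finsupp.single n 1 - Finsupp.single m 1)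
  rw [ip_sub_left, ip_single_left, ip_single_left, map_sub] at h0
  have h1 := (Complex.le_def.mp h0).1
  have h2 := congrArg Complex.re (h.conj_apply m n)
  simp at h1 h2
  linarith

lemma diag_nonneg {ρ : Module.End ℂ FockSpace}
    (hpos : ∀ ψ : FockSpace, 0 ≤ ip ψ (ρ ψ)) (n : ℕ) :
    0 ≤ (ρ (Finsupp.single n 1) n).re := by
  have h0 := hpos (Finsupp.single n 1)
  rw [ip_single_left] at h0
  exact (Complex.le_def.mp h0).1

/-- Diagonal entries of the dissipator, above the two lowest levels. -/
lemma lind_diag_add_two {ρ : Module.End ℂ FockSpace} (h : MemKf ρ) (α : ℝ) (n : ℕ) :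
    (lind (Lop α) (Ldag α) ρ (Finsupp.single (n + 2) 1) (n + 2)).re =
      ladder (n + 2) ^ 2 * (ρ (Finsupp.single (n + 4) 1) (n + 4)).re
      - ladder n ^ 2 * (ρ (Finsupp.single (n + 2) 1) (n + 2)).re
      - α ^ 2 * ladder (n + 2) * (ρ (Finsupp.single (n + 2) 1) (n + 4)).re
      + α ^ 2 * ladder n * (ρ (Finsupp.single n 1) (n + 2)).re := by
  have e1 := congrArg Complex.re (h.conj_apply (n + 2) (n + 4))
  have e2 := congrArg Complex.re (h.conj_apply n (n + 2))
  simp only [lind, LinearMap.sub_apply, LinearMap.smul_apply, LinearMap.add_apply,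
    Module.End.mul_apply, Ldag_single, Lop_single_add_two, map_sub, map_smul,
    Finsupp.sub_apply, Finsupp.smul_apply, Finsupp.add_apply, Ldag_apply_add_two, Lop_apply,
    smul_eq_mul, ← Complex.ofReal_pow]
  simp at e1 e2
  simp [-Complex.ofReal_pow]
  rw [e1, e2]
  ring

lemma lind_diag_of_lt_two {ρ : Module.End ℂ FockSpace} (h : MemKf ρ) (α : ℝ) {n : ℕ}
    (hn : n < 2) :
    (lind (Lop α) (Ldag α) ρ (Finsupp.single n 1) n).re =
      ladder n ^ 2 * (ρ (Finsupp.single (n + 2) 1) (n + 2)).re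
      - α ^ 2 * ladder n * (ρ (Finsupp.single n 1) (n + 2)).re := by
  have e1 := congrArg Complex.re (h.conj_apply n (n + 2))
  simp only [lind, LinearMap.sub_apply, LinearMap.smul_apply, LinearMap.add_apply,
    Module.End.mul_apply, Ldag_single, Lop_single_of_lt_two α hn, map_sub, map_smul, map_neg,
    Finsupp.sub_apply, Finsupp.smul_apply, Finsupp.add_apply, Finsupp.neg_apply,
    Ldag_apply_of_lt_two α _ hn, Lop_apply,
    smul_eq_mul, ← Complex.ofReal_pow]
  simp at e1
  simp [-Complex.ofReal_pow]
  rw [e1]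
  ring

lemma mul_Npow_diag (T : Module.End ℂ FockSpace) (ν : ℝ) (n : ℕ) :
    (T * Npow ν) (Finsupp.single n 1) n = (((n : ℝ) ^ ν : ℝ) : ℂ) * T (Finsupp.single n 1) n := by
  rw [Module.End.mul_apply, Npow_single, map_smul, Finsupp.smul_apply, smul_eq_mul]

lemma sum_diag_eq (p q f c : ℕ → ℝ) (β : ℝ) {D : ℕ → ℝ}
    (h0 : ∀ n < 2, D n = c n ^ 2 * p (n + 2) - β * c n * q n)
    (h2 : ∀ n, D (n + 2) = c (n + 2) ^ 2 * p (n + 4) - c n ^ 2 * p (n + 2)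
      - β * c (n + 2) * q (n + 2) + β * c n * q n) (K : ℕ) :
    ∑ n ∈ Finset.range (K + 2), f n * D n =
      ∑ n ∈ Finset.range K,
        (c n ^ 2 * p (n + 2) * (f n - f (n + 2)) + β * c n * q n * (f (n + 2) - f n))
      + f K * (c K ^ 2 * p (K + 2) - β * c K * q K)
      + f (K + 1) * (c (K + 1) ^ 2 * p (K + 3) - β * c (K + 1) * q (K + 1)) := by
  induction K with
  | zero =>
    simp [Finset.sum_range_succ, h0 0, h0 1]
  | succ K ih =>
    rw [show K + 1 + 2 = K + 2 + 1 by ring, Finset.sum_range_succ, ih, Finset.sum_range_succ, h2]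
    simp only [show K + 1 + 1 = K + 2 by ring, show K + 1 + 3 = K + 4 by ring,
      show K + 1 + 2 = K + 3 by ring]
    ring

lemma tangent_lower {ν : ℝ} (hν : 1 ≤ ν) {x : ℝ} (hx : 0 ≤ x) :
    2 * ν * x ^ (ν - 1) ≤ (x + 2) ^ ν - x ^ ν := by
  rcases hx.eq_or_lt with rfl | hx
  · rw [Real.zero_rpow (by linarith : ν ≠ 0), zero_add]
    rcases hν.eq_or_lt with rfl | hν
    · simp
    · rw [Real.zero_rpow (by linarith : ν - 1 ≠ 0)]
      simpa using Real.rpow_nonneg zero_le_two ν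
  · have h := one_add_mul_self_le_rpow_one_add (s := 2 / x) (by
      have : 0 < 2 / x := by positivity
      linarith) hν
    have hxx : x + 2 = x * (1 + 2 / x) := by field_simp
    have hp : x ^ ν = x ^ (ν - 1) * x := by
      rw [← Real.rpow_add_one hx.ne']; ring_nf
    rw [hxx, Real.mul_rpow hx.le (by positivity)]
    have : x ^ ν * (1 + ν * (2 / x)) ≤ x ^ ν * (1 + 2 / x) ^ ν := by gcongr
    have e : x ^ ν * (1 + ν * (2 / x)) = x ^ ν + 2 * ν * x ^ (ν - 1) := by
      rw [hp]; field_simp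
    linarith

lemma tangent_upper {ν : ℝ} (hν : 1 ≤ ν) {x : ℝ} (hx : 0 ≤ x) :
    (x + 2) ^ ν - x ^ ν ≤ 2 * ν * (x + 2) ^ (ν - 1) := by
  have h := one_add_mul_self_le_rpow_one_add (s := - (2 / (x + 2))) (by
      have : 2 / (x + 2) ≤ 1 := by rw [div_le_one (by positivity)]; linarith
      linarith) hν
  have hxx : x = (x + 2) * (1 + - (2 / (x + 2))) := by field_simp; ring
  have hy : 0 < x + 2 := by positivity
  have hp : (x + 2) ^ ν = (x + 2) ^ (ν - 1) * (x + 2) := by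
    rw [← Real.rpow_add_one hy.ne']; ring_nf
  have hnn : 0 ≤ 1 + - (2 / (x + 2)) := by
    have : 2 / (x + 2) ≤ 1 := by rw [div_le_one (by positivity)]; linarith
    linarith
  have hm : x ^ ν = (x + 2) ^ ν * (1 + - (2 / (x + 2))) ^ ν := by
    rw [← Real.mul_rpow hy.le hnn, ← hxx]
  have : (x + 2) ^ ν * (1 + ν * (- (2 / (x + 2)))) ≤ x ^ ν := by rw [hm]; gcongr
  have e : (x + 2) ^ ν * (1 + ν * (- (2 / (x + 2)))) =
      (x + 2) ^ ν - 2 * ν * (x + 2) ^ (ν - 1) := by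
    rw [hp]; field_simp
    ring
  linarith

lemma exists_nonneg_bound_of_eventually_nonpos {u : ℕ → ℝ}
    (h : ∀ᶠ n in Filter.atTop, u n ≤ 0) : ∃ μ : ℝ, 0 ≤ μ ∧ ∀ n, u n ≤ μ := by
  obtain ⟨N, hN⟩ := Filter.eventually_atTop.mp h
  refine ⟨∑ i ∈ Finset.range N, |u i|, by positivity, fun n => ?_⟩
  rcases lt_or_ge n N with hn | hn
  · exact (le_abs_self _).trans (Finset.single_le_sum (f := fun i => |u i|)
      (fun i _ => abs_nonneg _) (Finset.mem_range.mpr hn))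
  · exact (hN n hn).trans (by positivity)

/-- The forward difference of step two of `n ↦ n ^ ν`. -/
def powStep (ν : ℝ) (n : ℕ) : ℝ := ((n : ℝ) + 2) ^ ν - (n : ℝ) ^ ν

lemma powStep_nonneg {ν : ℝ} (hν : 1 ≤ ν) (n : ℕ) : 0 ≤ powStep ν n := by
  have := tangent_lower hν (Nat.cast_nonneg (α := ℝ) n)
  have : 0 ≤ 2 * ν * (n : ℝ) ^ (ν - 1) := by positivity
  unfold powStep
  linarith

lemma ladder_mul_powStep_le {ν : ℝ} (hν : 1 ≤ ν) (n : ℕ) :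
    ladder n * powStep ν n ≤ 2 * ν * ((n : ℝ) + 2) ^ ν := by
  have hy : (0 : ℝ) < (n : ℝ) + 2 := by positivity
  calc ladder n * powStep ν n
      ≤ ((n : ℝ) + 2) * (2 * ν * ((n : ℝ) + 2) ^ (ν - 1)) :=
        mul_le_mul (ladder_le n) (tangent_upper hν (Nat.cast_nonneg n)) (powStep_nonneg hν n) hy.le
    _ = 2 * ν * (((n : ℝ) + 2) ^ (ν - 1) * ((n : ℝ) + 2)) := by ring
    _ = _ := by rw [← Real.rpow_add_one hy.ne']; ring_nf

lemma ladder_sq_mul_powStep_ge {ν : ℝ} (hν : 1 ≤ ν) {n : ℕ} (hn : 0 < n) :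
    2 * ν * (n : ℝ) ^ (ν + 1) ≤ ladder n ^ 2 * powStep ν n := by
  have hx : (0 : ℝ) < n := by exact_mod_cast hn
  have e : (n : ℝ) ^ (ν + 1) = (n : ℝ) ^ 2 * (n : ℝ) ^ (ν - 1) := by
    rw [← Real.rpow_natCast, ← Real.rpow_add hx]; norm_num; ring_nf
  have hs : (n : ℝ) ^ 2 ≤ ladder n ^ 2 := by rw [ladder_sq]; nlinarith
  calc 2 * ν * (n : ℝ) ^ (ν + 1) = (n : ℝ) ^ 2 * (2 * ν * (n : ℝ) ^ (ν - 1)) := by rw [e]; ring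
    _ ≤ _ := mul_le_mul hs (tangent_lower hν hx.le) (by positivity) (by positivity)

lemma eventually_shift_bounds (ν : ℝ) {β : ℝ} (hβ : 0 ≤ β) :
    ∀ᶠ n : ℕ in Filter.atTop, 0 < n ∧
      ((n : ℝ) + 2) ^ (ν + 1) ≤ 7 / 6 * (n : ℝ) ^ (ν + 1) ∧
      β * ((n : ℝ) + 2) ^ ν ≤ 1 / 4 * (n : ℝ) ^ (ν + 1) := by
  have ht : Filter.Tendsto (fun n : ℕ => (1 + 2 / (n : ℝ)) ^ (ν + 1)) Filter.atTop (nhds 1) := by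
    have h1 : Filter.Tendsto (fun n : ℕ => 1 + 2 / (n : ℝ)) Filter.atTop (nhds (1 + 0)) :=
      tendsto_const_nhds.add (tendsto_const_div_atTop_nhds_zero_nat 2)
    have h2 := h1.rpow_const (p := ν + 1) (Or.inl (by norm_num))
    simpa using h2
  filter_upwards [ht.eventually_le_const (show (1 : ℝ) < 7 / 6 by norm_num),
    tendsto_natCast_atTop_atTop.eventually_ge_atTop (5 * β), Filter.eventually_gt_atTop 0]
    with n h76 hnβ hn
  have hx : (0 : ℝ) < n := by exact_mod_cast hn
  have h1 : (1 : ℝ) ≤ 1 + 2 / (n : ℝ) := le_add_of_nonneg_right (by positivity)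
  have h76' : (1 + 2 / (n : ℝ)) ^ ν ≤ 7 / 6 :=
    (Real.rpow_le_rpow_of_exponent_le h1 (by linarith)).trans h76
  have hxx : (n : ℝ) + 2 = n * (1 + 2 / n) := by field_simp
  have hpow : ∀ s : ℝ, ((n : ℝ) + 2) ^ s = (n : ℝ) ^ s * (1 + 2 / (n : ℝ)) ^ s := fun s => by
    rw [hxx, Real.mul_rpow hx.le (by positivity)]
  refine ⟨hn, ?_, ?_⟩
  · rw [hpow, mul_comm]
    gcongr
  · rw [hpow, Real.rpow_add_one hx.ne']
    have hp : 0 ≤ (n : ℝ) ^ ν := by positivity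
    calc β * ((n : ℝ) ^ ν * (1 + 2 / (n : ℝ)) ^ ν)
        ≤ β * ((n : ℝ) ^ ν * (7 / 6)) := by gcongr
      _ = (n : ℝ) ^ ν * (7 / 6 * β) := by ring
      _ ≤ (n : ℝ) ^ ν * (1 / 4 * n) := mul_le_mul_of_nonneg_left (by linarith) hp
      _ = _ := by ring

lemma exists_drift_bounds {ν : ℝ} (hν : 1 ≤ ν) {β : ℝ} (hβ : 0 ≤ β) :
    ∃ μ : ℝ, 0 ≤ μ ∧ ∀ n : ℕ,
      - (ladder n ^ 2 * powStep ν n) + β * (ladder n * powStep ν n) / 2 ≤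
        - (3 / 2) * ν * ((n : ℝ) + 2) ^ (ν + 1) + μ ∧
      β * (ladder n * powStep ν n) / 2 ≤ 1 / 2 * ν * (n : ℝ) ^ (ν + 1) + μ := by
  have hν0 : 0 ≤ ν := by linarith
  have key : ∀ᶠ n : ℕ in Filter.atTop,
      β * (ladder n * powStep ν n) / 2 ≤ 1 / 4 * ν * (n : ℝ) ^ (ν + 1) ∧
      2 * ν * (n : ℝ) ^ (ν + 1) ≤ ladder n ^ 2 * powStep ν n ∧
      ν * ((n : ℝ) + 2) ^ (ν + 1) ≤ 7 / 6 * ν * (n : ℝ) ^ (ν + 1) := by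
    filter_upwards [eventually_shift_bounds ν hβ] with n ⟨hn, h1, h2⟩
    refine ⟨?_, ladder_sq_mul_powStep_ge hν hn, ?_⟩
    · have := mul_le_mul_of_nonneg_left (ladder_mul_powStep_le hν n) hβ
      have := mul_le_mul_of_nonneg_left h2 hν0
      linarith
    · have := mul_le_mul_of_nonneg_left h1 hν0
      linarith
  have hnn : ∀ n : ℕ, 0 ≤ ν * (n : ℝ) ^ (ν + 1) := fun n => by positivity
  obtain ⟨μ₁, h₁, hb₁⟩ := exists_nonneg_bound_of_eventually_nonpos
    (u := fun n => - (ladder n ^ 2 * powStep ν n) + β * (ladder n * powStep ν n) / 2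
      + (3 / 2) * ν * ((n : ℝ) + 2) ^ (ν + 1)) (by
      filter_upwards [key] with n ⟨k1, k2, k3⟩
      linarith [hnn n])
  obtain ⟨μ₂, h₂, hb₂⟩ := exists_nonneg_bound_of_eventually_nonpos
    (u := fun n => β * (ladder n * powStep ν n) / 2 - 1 / 2 * ν * (n : ℝ) ^ (ν + 1)) (by
      filter_upwards [key] with n ⟨k1, k2, k3⟩
      linarith [hnn n])
  exact ⟨μ₁ + μ₂, by positivity, fun n => ⟨by linarith [hb₁ n], by linarith [hb₂ n]⟩⟩

lemma sum_drift_le {ν : ℝ} (hν : 1 ≤ ν) {β μ : ℝ} (hβ : 0 ≤ β) (hμ : 0 ≤ μ)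
    (hb : ∀ n : ℕ,
      - (ladder n ^ 2 * powStep ν n) + β * (ladder n * powStep ν n) / 2 ≤
        - (3 / 2) * ν * ((n : ℝ) + 2) ^ (ν + 1) + μ ∧
      β * (ladder n * powStep ν n) / 2 ≤ 1 / 2 * ν * (n : ℝ) ^ (ν + 1) + μ)
    {p q : ℕ → ℝ} (hp : ∀ n, 0 ≤ p n) (hq : ∀ n, q n ≤ (p n + p (n + 2)) / 2) {K : ℕ}
    (hsum : ∑ n ∈ Finset.range (K + 2), p n = 1) :
    ∑ n ∈ Finset.range K, (ladder n ^ 2 * p (n + 2) * (- powStep ν n)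
      + β * ladder n * q n * powStep ν n) ≤
      - ν * ∑ n ∈ Finset.range (K + 2), p n * (n : ℝ) ^ (ν + 1) + (2 * μ + 3 / 2 * ν) := by
  have hν0 : 0 ≤ ν := by linarith
  have term : ∀ n, ladder n ^ 2 * p (n + 2) * (- powStep ν n)
      + β * ladder n * q n * powStep ν n ≤
      (- (3 / 2) * ν * (p (n + 2) * ((n : ℝ) + 2) ^ (ν + 1)) + μ * p (n + 2)) +
      (1 / 2 * ν * (p n * (n : ℝ) ^ (ν + 1)) + μ * p n) := fun n => by
    have hc : 0 ≤ β * (ladder n * powStep ν n) :=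
      mul_nonneg hβ (mul_nonneg (ladder_nonneg n) (powStep_nonneg hν n))
    have t1 := mul_le_mul_of_nonneg_left (hq n) hc
    have t2 := mul_le_mul_of_nonneg_right (hb n).1 (hp (n + 2))
    have t3 := mul_le_mul_of_nonneg_right (hb n).2 (hp n)
    linarith
  refine (Finset.sum_le_sum fun n _ => term n).trans ?_
  simp only [Finset.sum_add_distrib, ← Finset.mul_sum]
  have shift : ∀ g : ℕ → ℝ, ∑ n ∈ Finset.range (K + 2), g n =
      ∑ n ∈ Finset.range K, g (n + 2) + g 1 + g 0 := fun g => by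
    rw [Finset.sum_range_succ', Finset.sum_range_succ']
  have trunc : ∀ g : ℕ → ℝ, (∀ n, 0 ≤ g n) →
      ∑ n ∈ Finset.range K, g n ≤ ∑ n ∈ Finset.range (K + 2), g n := fun g hg =>
    Finset.sum_le_sum_of_subset_of_nonneg (by simp) fun n _ _ => hg n
  have s1 := shift fun n => p n * (n : ℝ) ^ (ν + 1)
  have s2 := shift p
  have s3 := trunc p hp
  have s4 := trunc (fun n => p n * (n : ℝ) ^ (ν + 1)) fun n => mul_nonneg (hp n) (by positivity)
  rw [hsum] at s2 s3
  simp [Real.zero_rpow (by linarith : ν + 1 ≠ 0)] at s1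
  have hp1 : p 1 ≤ 1 := by
    have : 0 ≤ ∑ n ∈ Finset.range K, p (n + 2) := Finset.sum_nonneg fun n _ => hp _
    linarith [hp 0]
  have s5 : ∑ n ∈ Finset.range K, p (n + 2) ≤ 1 := by linarith [hp 0, hp 1]
  have m1 := mul_le_mul_of_nonneg_left s5 hμ
  have m2 := mul_le_mul_of_nonneg_left s3 hμ
  have m3 := mul_le_mul_of_nonneg_left s4 hν0
  have m4 := mul_le_mul_of_nonneg_left hp1 hν0
  have m5 := congrArg (fun y => ν * y) s1
  simp only [mul_add] at m5
  linarith

lemma rpow_sum_le {ν : ℝ} (hν : 1 ≤ ν) {p : ℕ → ℝ} (hp : ∀ n, 0 ≤ p n) {s : Finset ℕ}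
    (hsum : ∑ n ∈ s, p n = 1) :
    (∑ n ∈ s, p n * (n : ℝ) ^ ν) ^ ((ν + 1) / ν) ≤ ∑ n ∈ s, p n * (n : ℝ) ^ (ν + 1) := by
  have hν0 : 0 < ν := by linarith
  refine (Real.rpow_arith_mean_le_arith_mean_rpow s p (fun n => (n : ℝ) ^ ν)
    (fun n _ => hp n) hsum (fun n _ => by positivity) ?_).trans_eq ?_
  · rw [one_le_div hν0]; linarith
  · refine Finset.sum_congr rfl fun n _ => ?_
    rw [← Real.rpow_mul (Nat.cast_nonneg n), mul_div_cancel₀ _ hν0.ne']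

lemma trOp_re_eq_sum {T : Module.End ℂ FockSpace} {K : ℕ}
    (h : ∀ n, K ≤ n → T (Finsupp.single n 1) n = 0) :
    (trOp T).re = ∑ n ∈ Finset.range K, (T (Finsupp.single n 1) n).re := by
  unfold trOp
  rw [tsum_eq_sum (s := Finset.range K) fun n hn => h n (by simpa using hn), Complex.re_sum]

theorem stmt2 (ν : ℝ) (hν : 1 ≤ ν) (α : ℝ) (hα : 0 < α) :
    ∃ μ : ℝ, 0 ≤ μ ∧ ∀ ρ : Module.End ℂ FockSpace, IsQuantumState ρ →
      (trOp (lind (Lop α) (Ldag α) ρ * Npow ν)).re ≤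
        -ν * ((trOp (ρ * Npow ν)).re) ^ ((ν + 1) / ν) + μ := by
  obtain ⟨μ, hμ, hb⟩ := exists_drift_bounds hν (sq_nonneg α)
  refine ⟨2 * μ + 3 / 2 * ν, by positivity, fun ρ ⟨hK, hpos, htr⟩ => ?_⟩
  obtain ⟨M, hM⟩ := hK.exists_bound
  set p : ℕ → ℝ := fun n => (ρ (Finsupp.single n 1) n).re with hp
  set q : ℕ → ℝ := fun n => (ρ (Finsupp.single n 1) (n + 2)).re with hq
  have hp0 : ∀ n, 0 ≤ p n := diag_nonneg hpos
  have hpM : ∀ n, M ≤ n → p n = 0 := fun n hn => by simp [hp, hM n n (Or.inl hn)]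
  have hqM : ∀ n, M ≤ n → q n = 0 := fun n hn => by simp [hq, hM (n + 2) n (Or.inr hn)]
  have hsum : ∑ n ∈ Finset.range (M + 2), p n = 1 := by
    rw [← trOp_re_eq_sum fun n hn => hM n n (Or.inl (by omega)), htr, Complex.one_re]
  have hmom : (trOp (ρ * Npow ν)).re = ∑ n ∈ Finset.range (M + 2), p n * (n : ℝ) ^ ν := by
    rw [trOp_re_eq_sum (K := M + 2) fun n hn => by
      rw [mul_Npow_diag, hM n n (Or.inl (by omega)), mul_zero]]
    refine Finset.sum_congr rfl fun n _ => ?_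
    rw [mul_Npow_diag, Complex.re_ofReal_mul, mul_comm]
  have hlind : (trOp (lind (Lop α) (Ldag α) ρ * Npow ν)).re =
      ∑ n ∈ Finset.range M, (ladder n ^ 2 * p (n + 2) * (- powStep ν n)
        + α ^ 2 * ladder n * q n * powStep ν n) := by
    rw [trOp_re_eq_sum (K := M + 2)]
    · simp only [mul_Npow_diag, Complex.re_ofReal_mul]
      rw [sum_diag_eq p q (fun n => (n : ℝ) ^ ν) ladder (α ^ 2)
        (fun n hn => lind_diag_of_lt_two hK α hn) (fun n => lind_diag_add_two hK α n) M]
      simp [hpM, hqM, powStep]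
    · intro n hn
      have hz : ∀ k, M ≤ k → ρ (Finsupp.single k 1) = 0 := fun k hk =>
        Finsupp.ext fun m => hM m k (Or.inr hk)
      have hz' : ∀ ψ k, M ≤ k → ρ ψ k = 0 := fun ψ k hk => by
        have := hK.1 ψ (Finsupp.single k 1)
        rw [ip_single_right, hz k hk] at this
        simpa [ip] using this
      obtain ⟨m, rfl⟩ : ∃ m, n = m + 2 := ⟨n - 2, by omega⟩
      rw [mul_Npow_diag]
      simp only [lind, LinearMap.sub_apply, LinearMap.smul_apply, LinearMap.add_apply,
        Module.End.mul_apply, Finsupp.sub_apply, Finsupp.smul_apply, Finsupp.add_apply,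
        Lop_apply, hz' _ _ (show M ≤ m + 2 by omega), hz' _ _ (show M ≤ m + 2 + 2 by omega),
        hz _ (show M ≤ m + 2 by omega), map_zero]
      simp
  rw [hlind, hmom]
  refine (sum_drift_le hν (sq_nonneg α) hμ hb hp0
    (fun n => re_offdiag_le hK hpos (n + 2) n) hsum).trans ?_
  have := mul_le_mul_of_nonneg_left (rpow_sum_le hν hp0 hsum) (by linarith : 0 ≤ ν)
  linarith

end
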